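/- arXiv:1412.6777 — 2 statements merged into one kernel-verified Lean document; each statement's English description precedes it below -/
import Mathlib

section
/- Monotonicity along the steepest ascent curve at the critical value (part of Lemma 3.1): Fix an integer M ≥ 1 and set x* = (M+1)^{M+1}/M^M. Then (d/dφ) Re F̂(ζ(φ); x*) > 0 and (d/dφ) Re F̂(conj(ζ(φ)); x*) > 0 for every φ ∈ (0, π/(M+1)). -/
open Complex Real Set Filter

/-- The phase function `F̂(z; a)` (principal branch of `log`). -/
noncomputable def Fhat (M : ℕ) (z : ℂ) (a : ℝ) : ℂ :=
  ((M : ℂ) + 1) * z * (Complex.log z - 1) - (z - 1) * (Complex.log (z - 1) - 1) -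
    z * (Real.log a : ℂ)

/-- The parametrization `ζ(φ)` of the steepest ascent curve. -/
noncomputable def zeta (M : ℕ) (φ : ℝ) : ℂ :=
  ((Real.sin ((M + 1) * φ) / Real.sin (M * φ) : ℝ) : ℂ) * Complex.exp ((φ : ℂ) * Complex.I)

/-- The parametrization `v(φ)` of the spectral variable. -/
noncomputable def v (M : ℕ) (φ : ℝ) : ℝ :=
  Real.sin ((M + 1) * φ) ^ (M + 1) / (Real.sin φ * Real.sin (M * φ) ^ M)

/-- Strict concavity of the sine on `[0, π]`, along chords through the origin. -/
theorem mul_sin_lt_mul_sin {a b φ : ℝ} (ha : 0 < a) (hab : a < b) (hφ : 0 < φ)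
    (hb : b * φ < Real.pi) : a * Real.sin (b * φ) < b * Real.sin (a * φ) := by
  have hb0 : 0 < b := ha.trans hab
  have h := strictConcaveOn_sin_Icc.2 (Set.left_mem_Icc.2 Real.pi_pos.le)
    (⟨by positivity, hb.le⟩ : b * φ ∈ Set.Icc 0 Real.pi) (by positivity : 0 < b * φ).ne
    (sub_pos.2 ((div_lt_one hb0).2 hab)) (div_pos ha hb0) (sub_add_cancel _ _)
  simp only [Real.sin_zero, smul_eq_mul, mul_zero, zero_add] at h
  rw [show a / b * (b * φ) = a * φ by field_simp, div_mul_eq_mul_div, div_lt_iff₀ hb0] at h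
  linarith

theorem abs_sin_nat_mul_le (n : ℕ) (x : ℝ) : |Real.sin (n * x)| ≤ n * |Real.sin x| := by
  induction n with
  | zero => simp
  | succ k ih =>
    rw [show ((k + 1 : ℕ) : ℝ) * x = k * x + x by push_cast; ring, Real.sin_add]
    calc |Real.sin (k * x) * Real.cos x + Real.cos (k * x) * Real.sin x|
        ≤ |Real.sin (k * x)| * |Real.cos x| + |Real.cos (k * x)| * |Real.sin x| := by
          rw [← abs_mul, ← abs_mul]; exact abs_add_le _ _
      _ ≤ |Real.sin (k * x)| * 1 + 1 * |Real.sin x| := by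
          gcongr
          · exact Real.abs_cos_le_one _
          · exact Real.abs_cos_le_one _
      _ ≤ ((k + 1 : ℕ) : ℝ) * |Real.sin x| := by push_cast; linarith

theorem sin_succ_mul_lt (M : ℕ) (hM : 1 ≤ M) {x : ℝ} (hx : x ∈ Set.Ioo 0 Real.pi) :
    Real.sin (((M : ℝ) + 1) * x) < ((M : ℝ) + 1) * Real.sin x := by
  have hs : 0 < Real.sin x := Real.sin_pos_of_mem_Ioo hx
  have hM0 : (0 : ℝ) < M := by exact_mod_cast hM
  have h1 := abs_sin_nat_mul_le M x
  rw [abs_of_pos hs] at h1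
  have hc : |Real.cos x| < 1 := by
    rw [← sq_lt_one_iff_abs_lt_one]
    nlinarith [Real.sin_sq_add_cos_sq x]
  have h2 : Real.sin (M * x) * Real.cos x < M * Real.sin x := by
    calc Real.sin (M * x) * Real.cos x ≤ |Real.sin (M * x)| * |Real.cos x| := by
          rw [← abs_mul]; exact le_abs_self _
      _ ≤ M * Real.sin x * |Real.cos x| := by gcongr
      _ < M * Real.sin x * 1 := by gcongr
      _ = M * Real.sin x := mul_one _
  have h3 := mul_le_mul_of_nonneg_right (Real.cos_le_one (M * x)) hs.le
  rw [add_mul, one_mul, Real.sin_add]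
  linarith

section Curve

variable {M : ℕ} {φ : ℝ}

theorem sin_pos_of_mem_curve_range (hM : 1 ≤ M) (hφ : φ ∈ Set.Ioo (0 : ℝ) (Real.pi / ((M : ℝ) + 1))) :
    0 < Real.sin φ ∧ 0 < Real.sin (M * φ) ∧ 0 < Real.sin ((M + 1) * φ) := by
  have hM1 : (1 : ℝ) ≤ M := by exact_mod_cast hM
  have h0 := hφ.1
  have h := (lt_div_iff₀' (by positivity)).1 hφ.2
  refine ⟨Real.sin_pos_of_pos_of_lt_pi h0 ?_, Real.sin_pos_of_pos_of_lt_pi (by positivity) ?_,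
    Real.sin_pos_of_pos_of_lt_pi (by positivity) h⟩ <;> nlinarith

theorem zeta_sub_one (hs : Real.sin (M * φ) ≠ 0) :
    zeta M φ - 1 = ((Real.sin φ / Real.sin (M * φ) : ℝ) : ℂ) *
      Complex.exp ((((M + 1) * φ : ℝ) : ℂ) * Complex.I) := by
  have hA : ((M : ℝ) + 1) * φ = M * φ + φ := by ring
  unfold zeta
  rw [Complex.exp_mul_I, Complex.exp_mul_I, ← Complex.ofReal_cos, ← Complex.ofReal_sin,
    ← Complex.ofReal_cos, ← Complex.ofReal_sin, hA]
  apply Complex.ext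
  · simp only [Complex.sub_re, Complex.re_ofReal_mul, Complex.add_re, Complex.ofReal_re,
      Complex.mul_I_re, Complex.ofReal_im, Complex.one_re, neg_zero, add_zero]
    rw [Real.sin_add, Real.cos_add]
    field_simp
    linear_combination Real.sin (M * φ) * Real.sin_sq_add_cos_sq φ
  · simp only [Complex.sub_im, Complex.im_ofReal_mul, Complex.add_im, Complex.ofReal_re,
      Complex.mul_I_im, Complex.ofReal_im, Complex.one_im, zero_add, sub_zero]
    ring

theorem zeta_re (M : ℕ) (φ : ℝ) :
    (zeta M φ).re = Real.sin ((M + 1) * φ) / Real.sin (M * φ) * Real.cos φ := by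
  rw [zeta, Complex.re_ofReal_mul, Complex.exp_ofReal_mul_I_re]

theorem zeta_im (M : ℕ) (φ : ℝ) :
    (zeta M φ).im = Real.sin ((M + 1) * φ) / Real.sin (M * φ) * Real.sin φ := by
  rw [zeta, Complex.im_ofReal_mul, Complex.exp_ofReal_mul_I_im]

theorem zeta_im_pos (hM : 1 ≤ M) (hφ : φ ∈ Set.Ioo (0 : ℝ) (Real.pi / ((M : ℝ) + 1))) :
    0 < (zeta M φ).im := by
  obtain ⟨h1, h2, h3⟩ := sin_pos_of_mem_curve_range hM hφ
  rw [zeta_im]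
  positivity

theorem log_ofReal_mul_exp_mul_I {r θ : ℝ} (hr : 0 < r) (hθ : θ ∈ Set.Ioo 0 Real.pi) :
    Complex.log ((r : ℂ) * Complex.exp ((θ : ℂ) * Complex.I)) = (Real.log r : ℂ) + θ * Complex.I := by
  rw [Complex.log_ofReal_mul hr (Complex.exp_ne_zero _), Complex.log_exp]
  · simpa using by linarith [hθ.1, Real.pi_pos]
  · simpa using hθ.2.le

theorem hasDerivAt_Fhat (M : ℕ) (a : ℝ) {z : ℂ} (hz : 0 < z.im) :
    HasDerivAt (fun w => Fhat M w a)
      (((M : ℂ) + 1) * Complex.log z - Complex.log (z - 1) - (Real.log a : ℂ)) z := by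
  have hz0 : z ≠ 0 := by rintro rfl; simp at hz
  have hz1 : z - 1 ≠ 0 := by
    intro h
    have := congrArg Complex.im h
    simp at this
    exact hz.ne' this
  have hl : HasDerivAt Complex.log z⁻¹ z := Complex.hasDerivAt_log (Or.inr hz.ne')
  have hs : HasDerivAt (fun w : ℂ => w - 1) 1 z := (hasDerivAt_id z).sub_const 1
  have hl1 : HasDerivAt (fun w => Complex.log (w - 1)) (1 / (z - 1)) z :=
    hs.clog (Or.inr (by simpa using hz.ne'))
  have := ((((hasDerivAt_id z).const_mul ((M : ℂ) + 1)).mul (hl.sub_const 1)).sub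
    (hs.mul (hl1.sub_const 1))).sub ((hasDerivAt_id z).mul_const (Real.log a : ℂ))
  refine this.congr_deriv ?_
  simp only [id]
  field_simp
  ring

theorem deriv_Fhat_zeta (hM : 1 ≤ M) (hφ : φ ∈ Set.Ioo (0 : ℝ) (Real.pi / ((M : ℝ) + 1))) (a : ℝ) :
    ((M : ℂ) + 1) * Complex.log (zeta M φ) - Complex.log (zeta M φ - 1) - (Real.log a : ℂ) =
      ((Real.log (v M φ) - Real.log a : ℝ) : ℂ) := by
  obtain ⟨h1, h2, h3⟩ := sin_pos_of_mem_curve_range hM hφ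
  have hM1 : (1 : ℝ) ≤ M := by exact_mod_cast hM
  have h0 := hφ.1
  have h := (lt_div_iff₀' (by positivity)).1 hφ.2
  have hlog : Real.log (v M φ) = ((M : ℝ) + 1) *
      Real.log (Real.sin ((M + 1) * φ) / Real.sin (M * φ)) -
        Real.log (Real.sin φ / Real.sin (M * φ)) := by
    rw [v, Real.log_div (by positivity) (by positivity),
      Real.log_mul (by positivity) (by positivity), Real.log_pow, Real.log_pow,
      Real.log_div h3.ne' h2.ne', Real.log_div h1.ne' h2.ne']
    push_cast
    ring
  rw [zeta_sub_one h2.ne', zeta, log_ofReal_mul_exp_mul_I (by positivity) ⟨h0, by nlinarith⟩,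
    log_ofReal_mul_exp_mul_I (by positivity) ⟨by positivity, h⟩, hlog]
  push_cast
  ring

theorem v_lt_critical (hM : 1 ≤ M) (hφ : φ ∈ Set.Ioo (0 : ℝ) (Real.pi / ((M : ℝ) + 1))) :
    v M φ < ((M : ℝ) + 1) ^ (M + 1) / (M : ℝ) ^ M := by
  obtain ⟨h1, h2, h3⟩ := sin_pos_of_mem_curve_range hM hφ
  have hM1 : (1 : ℝ) ≤ M := by exact_mod_cast hM
  have h := (lt_div_iff₀' (by positivity)).1 hφ.2
  have ha := mul_sin_lt_mul_sin one_pos (by linarith : (1 : ℝ) < M + 1) hφ.1 h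
  have hb := mul_sin_lt_mul_sin (by positivity) (by linarith : (M : ℝ) < M + 1) hφ.1 h
  rw [one_mul, one_mul] at ha
  rw [v, div_lt_div_iff₀ (by positivity) (by positivity)]
  calc Real.sin ((M + 1) * φ) ^ (M + 1) * (M : ℝ) ^ M
      = Real.sin ((M + 1) * φ) * (M * Real.sin ((M + 1) * φ)) ^ M := by ring
    _ ≤ Real.sin ((M + 1) * φ) * ((M + 1) * Real.sin (M * φ)) ^ M := by gcongr
    _ < ((M + 1) * Real.sin φ) * ((M + 1) * Real.sin (M * φ)) ^ M := by gcongr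
    _ = ((M : ℝ) + 1) ^ (M + 1) * (Real.sin φ * Real.sin (M * φ) ^ M) := by
      rw [mul_pow]; ring

theorem differentiableAt_zeta (hs : Real.sin (M * φ) ≠ 0) : DifferentiableAt ℝ (zeta M) φ := by
  have hq : DifferentiableAt ℝ (fun t : ℝ => Real.sin ((M + 1) * t) / Real.sin (M * t)) φ := by
    fun_prop (disch := exact hs)
  have he : DifferentiableAt ℝ (fun t : ℝ => Complex.exp ((t : ℂ) * Complex.I)) φ :=
    ((Complex.ofRealCLM.differentiableAt (x := φ)).mul_const Complex.I).cexp
  exact (hq.hasDerivAt.ofReal_comp.differentiableAt).mul he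

theorem deriv_zeta_re_neg (hM : 1 ≤ M) (hφ : φ ∈ Set.Ioo (0 : ℝ) (Real.pi / ((M : ℝ) + 1))) :
    (deriv (zeta M) φ).re < 0 := by
  obtain ⟨h1, h2, h3⟩ := sin_pos_of_mem_curve_range hM hφ
  have hM1 : (1 : ℝ) ≤ M := by exact_mod_cast hM
  have h := (lt_div_iff₀' (by positivity)).1 hφ.2
  have hre : HasDerivAt (fun t => (zeta M t).re) (deriv (zeta M) φ).re φ :=
    Complex.reCLM.hasFDerivAt.comp_hasDerivAt φ (differentiableAt_zeta h2.ne').hasDerivAt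
  have hsin (c : ℝ) : HasDerivAt (fun t => Real.sin (c * t)) (Real.cos (c * φ) * c) φ := by
    simpa using ((hasDerivAt_id φ).const_mul c).sin
  have hre' := ((hsin (M + 1)).div (hsin M) h2.ne').mul (Real.hasDerivAt_cos φ)
  have heq : (fun t => (zeta M t).re) = fun t =>
      Real.sin ((M + 1) * t) / Real.sin (M * t) * Real.cos t := funext (zeta_re M)
  rw [heq] at hre
  rw [hre.unique hre']
  have hlt := sin_succ_mul_lt M hM (x := 2 * φ) ⟨by linarith [hφ.1], by nlinarith [hφ.1]⟩
  rw [mul_left_comm, Real.sin_two_mul, Real.sin_two_mul] at hlt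
  have e1 : Real.cos ((M + 1) * φ) =
      Real.cos (M * φ) * Real.cos φ - Real.sin (M * φ) * Real.sin φ := by
    rw [← Real.cos_add]; ring_nf
  have e2 : Real.sin φ = Real.sin ((M + 1) * φ) * Real.cos (M * φ) -
      Real.cos ((M + 1) * φ) * Real.sin (M * φ) := by
    rw [← Real.sin_sub]; ring_nf
  have key : (Real.cos ((M + 1) * φ) * (M + 1) * Real.sin (M * φ) -
        Real.sin ((M + 1) * φ) * (Real.cos (M * φ) * M)) / Real.sin (M * φ) ^ 2 * Real.cos φ +
      Real.sin ((M + 1) * φ) / Real.sin (M * φ) * -Real.sin φ =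
      (Real.sin ((M + 1) * φ) * Real.cos ((M + 1) * φ) -
        (M + 1) * (Real.sin φ * Real.cos φ)) / Real.sin (M * φ) ^ 2 := by
    field_simp
    linear_combination -Real.sin ((M + 1) * φ) * e1 + (M + 1) * Real.cos φ * e2
  refine lt_of_eq_of_lt key (div_neg_of_neg_of_pos ?_ (by positivity))
  linarith

theorem deriv_Fhat_zeta_re_pos (hM : 1 ≤ M)
    (hφ : φ ∈ Set.Ioo (0 : ℝ) (Real.pi / ((M : ℝ) + 1))) :
    0 < deriv (fun t : ℝ =>
      (Fhat M (zeta M t) (((M : ℝ) + 1) ^ (M + 1) / (M : ℝ) ^ M)).re) φ := by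
  obtain ⟨h1, h2, h3⟩ := sin_pos_of_mem_curve_range hM hφ
  set a : ℝ := ((M : ℝ) + 1) ^ (M + 1) / (M : ℝ) ^ M with ha
  have hF := hasDerivAt_Fhat M a (zeta_im_pos hM hφ)
  rw [deriv_Fhat_zeta hM hφ] at hF
  have hcomp : HasDerivAt (fun t => Fhat M (zeta M t) a) _ φ :=
    hF.scomp φ (differentiableAt_zeta h2.ne').hasDerivAt
  have hre : HasDerivAt (fun t => (Fhat M (zeta M t) a).re) _ φ :=
    Complex.reCLM.hasFDerivAt.comp_hasDerivAt φ hcomp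
  rw [hre.deriv]
  have hv : 0 < v M φ := by unfold v; positivity
  have hlog := Real.log_lt_log hv (v_lt_critical hM hφ)
  simp only [smul_eq_mul, Complex.reCLM_apply, Complex.re_mul_ofReal]
  exact mul_pos_of_neg_of_neg (deriv_zeta_re_neg hM hφ) (sub_neg.2 hlog)

theorem Fhat_conj (M : ℕ) (a : ℝ) {z : ℂ} (hz : 0 < z.im) :
    Fhat M ((starRingEnd ℂ) z) a = (starRingEnd ℂ) (Fhat M z a) := by
  have h0 : z.arg ≠ Real.pi := fun h => hz.ne' (Complex.arg_eq_pi_iff.1 h).2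
  have h1 : (z - 1).arg ≠ Real.pi := fun h =>
    hz.ne' (by simpa using (Complex.arg_eq_pi_iff.1 h).2)
  have h2 := Complex.log_conj (z - 1) h1
  rw [map_sub, map_one] at h2
  simp [Fhat, Complex.log_conj z h0, h2]

end Curve

/-- Monotonicity along the steepest ascent curve at the critical value
(part of Lemma 3.1). -/
theorem monotonicity_along_ascent_curve_critical
    (M : ℕ) (hM : 1 ≤ M) :
    ∀ φ ∈ Set.Ioo (0 : ℝ) (Real.pi / ((M : ℝ) + 1)),
      0 < deriv (fun t : ℝ =>
            (Fhat M (zeta M t) (((M : ℝ) + 1) ^ (M + 1) / (M : ℝ) ^ M)).re) φ ∧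
      0 < deriv (fun t : ℝ =>
            (Fhat M ((starRingEnd ℂ) (zeta M t))
              (((M : ℝ) + 1) ^ (M + 1) / (M : ℝ) ^ M)).re) φ := by
  intro φ hφ
  refine ⟨deriv_Fhat_zeta_re_pos hM hφ, ?_⟩
  have heq : (fun t : ℝ => (Fhat M ((starRingEnd ℂ) (zeta M t))
      (((M : ℝ) + 1) ^ (M + 1) / (M : ℝ) ^ M)).re) =ᶠ[nhds φ] fun t : ℝ =>
      (Fhat M (zeta M t) (((M : ℝ) + 1) ^ (M + 1) / (M : ℝ) ^ M)).re := by
    filter_upwards [Ioo_mem_nhds hφ.1 hφ.2] with t ht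
    rw [Fhat_conj M _ (zeta_im_pos hM ht), Complex.conj_re]
  rw [heq.deriv_eq]
  exact deriv_Fhat_zeta_re_pos hM hφ
end

section
/- Properties of the trigonometric parametrization: Fix an integer M ≥ 1. Then: (i) the function v(φ) = (sin((M+1)φ))^{M+1}/(sin(φ)·(sin(Mφ))^{M}) is strictly decreasing on (0, π/(M+1)), tends to (M+1)^{M+1}/M^M as φ → 0+ and to 0 as φ → π/(M+1)−, and hence is a bijection from (0, π/(M+1)) onto (0, (M+1)^{M+1}/M^M); (ii) the modulus |ζ(φ)| = sin((M+1)φ)/sin(Mφ) is strictly decreasing on (0, π/(M+1)); (iii) the real part Re ζ(φ) = sin((M+1)φ)·cos(φ)/sin(Mφ) has strictly negative derivative on (0, π/(M+1)). -/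
open Complex Real Set Filter

theorem abs_sin_natCast_mul_le {x : ℝ} (h0 : 0 ≤ Real.sin x) (n : ℕ) :
    |Real.sin (n * x)| ≤ n * Real.sin x := by
  induction n with
  | zero => simp
  | succ n ih =>
    have h : Real.sin ((n + 1 : ℕ) * x) =
        Real.sin (n * x) * Real.cos x + Real.cos (n * x) * Real.sin x := by
      rw [← Real.sin_add]; push_cast; ring_nf
    rw [h]
    refine (abs_add_le _ _).trans ?_
    rw [abs_mul, abs_mul, abs_of_nonneg h0]
    have h1 := mul_le_mul_of_nonneg_left (Real.abs_cos_le_one x) (abs_nonneg (Real.sin (n * x)))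
    have h2 := mul_le_mul_of_nonneg_right (Real.abs_cos_le_one (n * x)) h0
    push_cast
    linarith

theorem sin_natCast_mul_lt {x : ℝ} (h0 : 0 < x) (hx : x < Real.pi) {n : ℕ} (hn : 2 ≤ n) :
    Real.sin (n * x) < n * Real.sin x := by
  obtain ⟨n, rfl⟩ : ∃ k, n = k + 1 := ⟨n - 1, by omega⟩
  have hs : 0 < Real.sin x := Real.sin_pos_of_pos_of_lt_pi h0 hx
  have hc : |Real.cos x| < 1 := by
    rw [← sq_lt_one_iff_abs_lt_one]
    nlinarith [Real.sin_sq_add_cos_sq x]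
  have hn0 : (0 : ℝ) < n := by
    exact_mod_cast (by omega : 0 < n)
  have h : Real.sin ((n + 1 : ℕ) * x) =
      Real.sin (n * x) * Real.cos x + Real.cos (n * x) * Real.sin x := by
    rw [← Real.sin_add]; push_cast; ring_nf
  have h1 : Real.sin (n * x) * Real.cos x ≤ n * Real.sin x * |Real.cos x| := by
    refine (le_abs_self _).trans ?_
    rw [abs_mul]
    exact mul_le_mul_of_nonneg_right (abs_sin_natCast_mul_le hs.le n) (abs_nonneg _)
  have h2 : n * Real.sin x * |Real.cos x| < n * Real.sin x * 1 :=
    mul_lt_mul_of_pos_left hc (mul_pos hn0 hs)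
  have h3 := mul_le_mul_of_nonneg_right (Real.cos_le_one (n * x)) hs.le
  rw [h]
  push_cast
  linarith

theorem sin_pos_of_mem_Ioo {M : ℕ} {φ : ℝ}
    (hφ : φ ∈ Set.Ioo (0 : ℝ) (Real.pi / ((M : ℝ) + 1))) {c : ℝ} (hc : 0 < c)
    (hcM : c ≤ (M : ℝ) + 1) : 0 < Real.sin (c * φ) := by
  have hM : (0 : ℝ) < (M : ℝ) + 1 := by positivity
  have h := (lt_div_iff₀ hM).1 hφ.2
  refine Real.sin_pos_of_pos_of_lt_pi (mul_pos hc hφ.1) ?_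
  nlinarith [mul_le_mul_of_nonneg_right hcM hφ.1.le]

theorem hasDerivAt_sin_const_mul (c x : ℝ) :
    HasDerivAt (fun t : ℝ => Real.sin (c * t)) (Real.cos (c * x) * c) x := by
  simpa using ((hasDerivAt_id x).const_mul c).sin

theorem strictAntiOn_sin_div_sin {M : ℕ} (hM : 1 ≤ M) :
    StrictAntiOn (fun φ : ℝ => Real.sin ((M + 1) * φ) / Real.sin (M * φ))
      (Set.Ioo (0 : ℝ) (Real.pi / ((M : ℝ) + 1))) := by
  have hM0 : (1 : ℝ) ≤ M := by exact_mod_cast hM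
  have hder : ∀ x ∈ Set.Ioo (0 : ℝ) (Real.pi / ((M : ℝ) + 1)), HasDerivAt
      (fun φ : ℝ => Real.sin ((M + 1) * φ) / Real.sin (M * φ))
      ((Real.cos ((M + 1) * x) * (M + 1) * Real.sin (M * x) -
        Real.sin ((M + 1) * x) * (Real.cos (M * x) * M)) / Real.sin (M * x) ^ 2) x :=
    fun x hx => (hasDerivAt_sin_const_mul _ x).div (hasDerivAt_sin_const_mul _ x)
      (sin_pos_of_mem_Ioo hx (by linarith) (by linarith)).ne'
  refine strictAntiOn_of_deriv_neg (convex_Ioo _ _)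
    (fun x hx => (hder x hx).continuousAt.continuousWithinAt) fun x hx => ?_
  rw [interior_Ioo] at hx
  rw [(hder x hx).deriv]
  have hs : 0 < Real.sin (M * x) := sin_pos_of_mem_Ioo hx (by linarith) (by linarith)
  refine div_neg_of_neg_of_pos ?_ (by positivity)
  have hxpi : x < Real.pi := by
    refine hx.2.trans_le (div_le_self Real.pi_pos.le (by linarith))
  have key := sin_natCast_mul_lt hx.1 hxpi (n := 2 * M + 1) (by omega)
  have e1 : Real.sin ((2 * M + 1 : ℕ) * x) =
      Real.sin ((M + 1) * x) * Real.cos (M * x) + Real.cos ((M + 1) * x) * Real.sin (M * x) := by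
    rw [← Real.sin_add]; push_cast; ring_nf
  have e2 : Real.sin x =
      Real.sin ((M + 1) * x) * Real.cos (M * x) - Real.cos ((M + 1) * x) * Real.sin (M * x) := by
    rw [← Real.sin_sub]; ring_nf
  rw [e1, e2] at key
  push_cast at key
  linarith

theorem strictAntiOn_sin_natCast_mul_div_sin {M : ℕ} (hM : 1 ≤ M) :
    StrictAntiOn (fun φ : ℝ => Real.sin ((M + 1) * φ) / Real.sin φ)
      (Set.Ioo (0 : ℝ) (Real.pi / ((M : ℝ) + 1))) := by
  induction M, hM using Nat.le_induction with
  | base => simpa using strictAntiOn_sin_div_sin (le_refl 1)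
  | succ M hM ih =>
    have hM0 : (1 : ℝ) ≤ M := by exact_mod_cast hM
    have hsub : Set.Ioo (0 : ℝ) (Real.pi / (((M + 1 : ℕ) : ℝ) + 1)) ⊆
        Set.Ioo (0 : ℝ) (Real.pi / ((M : ℝ) + 1)) := by
      refine Set.Ioo_subset_Ioo_right ?_
      push_cast
      exact div_le_div_of_nonneg_left Real.pi_pos.le (by positivity) (by linarith)
    have hanti := strictAntiOn_sin_div_sin (M := M + 1) (by omega)
    have hpos : ∀ x ∈ Set.Ioo (0 : ℝ) (Real.pi / (((M + 1 : ℕ) : ℝ) + 1)),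
        0 < Real.sin x ∧ 0 < Real.sin ((M + 1) * x) ∧
          0 < Real.sin (((M + 1 : ℕ) + 1) * x) := by
      intro x hx
      refine ⟨?_, ?_, ?_⟩
      · simpa using sin_pos_of_mem_Ioo hx one_pos (by push_cast; linarith)
      · exact sin_pos_of_mem_Ioo hx (by linarith) (by push_cast; linarith)
      · exact sin_pos_of_mem_Ioo hx (by positivity) le_rfl
    intro x hx y hy hxy
    have h1 := ih (hsub hx) (hsub hy) hxy
    have h2 := hanti hx hy hxy
    obtain ⟨x1, x2, x3⟩ := hpos x hx
    obtain ⟨y1, y2, y3⟩ := hpos y hy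
    simp only [Nat.cast_add, Nat.cast_one] at h1 h2 x3 y3 ⊢
    have h3 := mul_lt_mul'' h2 h1 (by positivity) (by positivity)
    rwa [div_mul_div_cancel₀ x2.ne', div_mul_div_cancel₀ y2.ne'] at h3

theorem v_eq_pow_mul (M : ℕ) (φ : ℝ) :
    v M φ = (Real.sin ((M + 1) * φ) / Real.sin (M * φ)) ^ M *
      (Real.sin ((M + 1) * φ) / Real.sin φ) := by
  rw [v, div_pow, div_mul_div_comm, pow_succ, mul_comm (Real.sin φ)]

theorem strictAntiOn_v {M : ℕ} (hM : 1 ≤ M) :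
    StrictAntiOn (v M) (Set.Ioo (0 : ℝ) (Real.pi / ((M : ℝ) + 1))) := by
  have hM0 : (1 : ℝ) ≤ M := by exact_mod_cast hM
  intro x hx y hy hxy
  have h1 := strictAntiOn_sin_div_sin hM hx hy hxy
  have h2 := strictAntiOn_sin_natCast_mul_div_sin hM hx hy hxy
  have y1 : 0 < Real.sin y := by
    simpa using sin_pos_of_mem_Ioo hy one_pos (by linarith)
  have y2 : 0 < Real.sin (M * y) := sin_pos_of_mem_Ioo hy (by linarith) (by linarith)
  have y3 : 0 < Real.sin ((M + 1) * y) := sin_pos_of_mem_Ioo hy (by linarith) le_rfl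
  rw [v_eq_pow_mul, v_eq_pow_mul]
  exact mul_lt_mul'' (pow_lt_pow_left₀ h1 (by positivity) (by omega)) h2
    (by positivity) (by positivity)

theorem continuousAt_v {M : ℕ} {φ : ℝ} (h1 : Real.sin φ ≠ 0) (h2 : Real.sin (M * φ) ≠ 0) :
    ContinuousAt (v M) φ := by
  unfold v
  exact ContinuousAt.div (by fun_prop) (by fun_prop) (mul_ne_zero h1 (pow_ne_zero _ h2))

theorem tendsto_sin_const_mul_div (c : ℝ) :
    Tendsto (fun t : ℝ => Real.sin (c * t) / t) (nhdsWithin 0 (Set.Ioi 0)) (nhds c) := by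
  have h := (hasDerivAt_sin_const_mul c 0).tendsto_slope_zero_right
  simpa [div_eq_inv_mul] using h

theorem tendsto_v_zero {M : ℕ} (hM : 1 ≤ M) :
    Tendsto (v M) (nhdsWithin 0 (Set.Ioi 0))
      (nhds (((M : ℝ) + 1) ^ (M + 1) / (M : ℝ) ^ M)) := by
  have hM0 : (0 : ℝ) < M := by exact_mod_cast hM
  have h1 := tendsto_sin_const_mul_div 1
  have h := ((tendsto_sin_const_mul_div ((M : ℝ) + 1)).pow (M + 1)).div
    (h1.mul ((tendsto_sin_const_mul_div M).pow M)) (by positivity)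
  rw [one_mul] at h
  refine h.congr' ?_
  filter_upwards [self_mem_nhdsWithin] with t ht
  have ht0 : t ≠ 0 := ne_of_gt ht
  simp only [Pi.div_apply, one_mul, div_pow, v]
  rw [div_mul_div_comm, ← pow_succ', div_div_div_cancel_right₀ (pow_ne_zero _ ht0)]

theorem tendsto_v_right {M : ℕ} (hM : 1 ≤ M) :
    Tendsto (v M)
      (nhdsWithin (Real.pi / ((M : ℝ) + 1)) (Set.Iio (Real.pi / ((M : ℝ) + 1))))
      (nhds 0) := by
  have hM0 : (1 : ℝ) ≤ M := by exact_mod_cast hM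
  have hM1 : (0 : ℝ) < (M : ℝ) + 1 := by positivity
  have hlt : Real.pi / ((M : ℝ) + 1) < Real.pi := div_lt_self Real.pi_pos (by linarith)
  have hs : 0 < Real.sin (Real.pi / ((M : ℝ) + 1)) :=
    Real.sin_pos_of_pos_of_lt_pi (by positivity) hlt
  have hs' : Real.sin (M * (Real.pi / ((M : ℝ) + 1))) = Real.sin (Real.pi / ((M : ℝ) + 1)) := by
    rw [← Real.sin_pi_sub]
    congr 1
    field_simp
    ring
  have hc : ContinuousAt (v M) (Real.pi / ((M : ℝ) + 1)) :=
    continuousAt_v hs.ne' (hs' ▸ hs.ne')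
  have hv : v M (Real.pi / ((M : ℝ) + 1)) = 0 := by
    simp [v, mul_div_cancel₀ Real.pi hM1.ne']
  rw [ContinuousAt, hv] at hc
  exact hc.mono_left nhdsWithin_le_nhds

theorem bijOn_v {M : ℕ} (hM : 1 ≤ M) :
    Set.BijOn (v M) (Set.Ioo (0 : ℝ) (Real.pi / ((M : ℝ) + 1)))
      (Set.Ioo (0 : ℝ) (((M : ℝ) + 1) ^ (M + 1) / (M : ℝ) ^ M)) := by
  have hM0 : (1 : ℝ) ≤ M := by exact_mod_cast hM
  have hanti := strictAntiOn_v hM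
  have hpi : (0 : ℝ) < Real.pi / ((M : ℝ) + 1) := div_pos Real.pi_pos (by positivity)
  have hpos : ∀ x ∈ Set.Ioo (0 : ℝ) (Real.pi / ((M : ℝ) + 1)),
      0 < Real.sin x ∧ 0 < Real.sin (M * x) ∧ 0 < Real.sin ((M + 1) * x) := fun x hx =>
    ⟨by simpa using sin_pos_of_mem_Ioo hx one_pos (by linarith),
      sin_pos_of_mem_Ioo hx (by linarith) (by linarith),
      sin_pos_of_mem_Ioo hx (by linarith) le_rfl⟩
  refine ⟨fun x hx => ⟨?_, ?_⟩, hanti.injOn, ?_⟩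
  · obtain ⟨h1, h2, h3⟩ := hpos x hx
    unfold v
    positivity
  · have hx2 : x / 2 ∈ Set.Ioo (0 : ℝ) (Real.pi / ((M : ℝ) + 1)) :=
      ⟨half_pos hx.1, (half_lt_self hx.1).trans hx.2⟩
    refine (hanti hx2 hx (half_lt_self hx.1)).trans_le (ge_of_tendsto (tendsto_v_zero hM) ?_)
    filter_upwards [Ioo_mem_nhdsGT hx2.1] with t ht
    exact (hanti ⟨ht.1, ht.2.trans hx2.2⟩ hx2 ht.2).le
  · have := nhdsGT_neBot (0 : ℝ)
    have := nhdsLT_neBot (Real.pi / ((M : ℝ) + 1))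
    exact isPreconnected_Ioo.intermediate_value_Ioo
      (le_principal_iff.2 (Ioo_mem_nhdsLT hpi)) (le_principal_iff.2 (Ioo_mem_nhdsGT hpi))
      (fun x hx => (continuousAt_v (hpos x hx).1.ne' (hpos x hx).2.1.ne').continuousWithinAt)
      (tendsto_v_right hM) (tendsto_v_zero hM)

theorem deriv_sin_mul_cos_div_sin_neg {M : ℕ} (hM : 1 ≤ M) {φ : ℝ}
    (hφ : φ ∈ Set.Ioo (0 : ℝ) (Real.pi / ((M : ℝ) + 1))) :
    deriv (fun t : ℝ => Real.sin ((M + 1) * t) * Real.cos t / Real.sin (M * t)) φ < 0 := by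
  have hM0 : (1 : ℝ) ≤ M := by exact_mod_cast hM
  have hs : 0 < Real.sin (M * φ) := sin_pos_of_mem_Ioo hφ (by linarith) (by linarith)
  have hder := ((hasDerivAt_sin_const_mul ((M : ℝ) + 1) φ).mul (Real.hasDerivAt_cos φ)).div
    (hasDerivAt_sin_const_mul (M : ℝ) φ) hs.ne'
  refine hder.deriv.trans_lt (div_neg_of_neg_of_pos ?_ (by positivity))
  have hφpi : 2 * φ < Real.pi := by
    have h := (lt_div_iff₀ (by linarith)).1 hφ.2
    nlinarith [hφ.1]
  have key := sin_natCast_mul_lt (mul_pos two_pos hφ.1) hφpi (n := M + 1) (by omega)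
  have e1 : Real.sin ((M + 1 : ℕ) * (2 * φ)) =
      2 * Real.sin ((M + 1) * φ) * Real.cos ((M + 1) * φ) := by
    rw [← Real.sin_two_mul]; push_cast; ring_nf
  have e2 : Real.sin ((M + 1) * φ) =
      Real.sin (M * φ) * Real.cos φ + Real.cos (M * φ) * Real.sin φ := by
    rw [← Real.sin_add]; ring_nf
  have e3 : Real.cos ((M + 1) * φ) =
      Real.cos (M * φ) * Real.cos φ - Real.sin (M * φ) * Real.sin φ := by
    rw [← Real.cos_add]; ring_nf
  rw [e1, e2, e3, Real.sin_two_mul] at key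
  push_cast at key
  simp only [Pi.mul_apply]
  rw [e2, e3]
  have h1 := Real.sin_sq (M * φ)
  linear_combination key / 2 - (M + 1) * Real.sin φ * Real.cos φ * h1

/-- Properties of the trigonometric parametrization: (i) `v` is strictly decreasing
on `(0, π/(M+1))`, with limits `(M+1)^{M+1}/M^M` at `0⁺` and `0` at `(π/(M+1))⁻`, hence
a bijection onto `(0, (M+1)^{M+1}/M^M)`; (ii) `|ζ(φ)| = sin((M+1)φ)/sin(Mφ)` is strictly
decreasing; (iii) `Re ζ(φ) = sin((M+1)φ) cos(φ)/sin(Mφ)` has strictly negative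
derivative. -/
theorem trigonometric_parametrization_properties
    (M : ℕ) (hM : 1 ≤ M) :
    StrictAntiOn (v M) (Set.Ioo (0 : ℝ) (Real.pi / ((M : ℝ) + 1))) ∧
    Tendsto (v M) (nhdsWithin 0 (Set.Ioi 0))
      (nhds (((M : ℝ) + 1) ^ (M + 1) / (M : ℝ) ^ M)) ∧
    Tendsto (v M)
      (nhdsWithin (Real.pi / ((M : ℝ) + 1)) (Set.Iio (Real.pi / ((M : ℝ) + 1))))
      (nhds 0) ∧
    Set.BijOn (v M) (Set.Ioo (0 : ℝ) (Real.pi / ((M : ℝ) + 1)))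
      (Set.Ioo (0 : ℝ) (((M : ℝ) + 1) ^ (M + 1) / (M : ℝ) ^ M)) ∧
    StrictAntiOn (fun φ : ℝ => Real.sin ((M + 1) * φ) / Real.sin (M * φ))
      (Set.Ioo (0 : ℝ) (Real.pi / ((M : ℝ) + 1))) ∧
    (∀ φ ∈ Set.Ioo (0 : ℝ) (Real.pi / ((M : ℝ) + 1)),
      deriv (fun t : ℝ => Real.sin ((M + 1) * t) * Real.cos t / Real.sin (M * t)) φ < 0) := by
  exact ⟨strictAntiOn_v hM, tendsto_v_zero hM, tendsto_v_right hM, bijOn_v hM,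
    strictAntiOn_sin_div_sin hM, fun _ => deriv_sin_mul_cos_div_sin_neg hM⟩
end
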